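/- Every nonempty injective metric space X is contractible: there exist a point p ∈ X and a continuous map H : X × [0,1] → X with H(x, 0) = x and H(x, 1) = p for all x ∈ X. -/

import Mathlib

universe u v w

/-- A metric space `X` is injective if for all metric spaces `Y` and `Z`, every isometric
embedding `i : Y → Z`, and every 1-Lipschitz map `f : Y → X`, there exists a 1-Lipschitz
map `g : Z → X` with `g ∘ i = f`. -/
def IsInjMetric (X : Type w) [MetricSpace X] : Prop :=
  ∀ (Y : Type u) (Z : Type v) [MetricSpace Y] [MetricSpace Z]
    (i : Y → Z) (f : Y → X), Isometry i → LipschitzWith 1 f →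
      ∃ g : Z → X, LipschitzWith 1 g ∧ ∀ y, g (i y) = f y

open Set Filter Topology

/-- Conical contraction of a compact subset, using only separable test spaces. -/
theorem inj_cone (X : Type w) [MetricSpace X] (hX : IsInjMetric.{u, v} X)
    (K : Set X) (hK : IsCompact K) (c : X) (hc : c ∈ K) :
    ∃ h : X → ℝ → X, (∀ k, h k 0 = c) ∧ (∀ k ∈ K, h k 1 = k) ∧
      ContinuousOn (fun q : X × ℝ => h q.1 q.2) (K ×ˢ univ) ∧
      ∀ k ∈ K, ∀ y ∈ K, ∀ s : ℝ, 0 ≤ s → s ≤ 1 →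
        dist (h k s) y ≤ s * dist k y + (1 - s) * dist c y := by
  classical
  haveI : CompactSpace K := isCompact_iff_compactSpace.1 hK
  let E := lp (fun _ : ℕ => ℝ) ⊤
  let e : K → E := kuratowskiEmbedding K
  have he : Isometry e := kuratowskiEmbedding.isometry K
  have hinv : ∀ y : range e, ∃ k : K, e k = y := fun y => y.2
  choose inv hinv using hinv
  obtain ⟨r, hr, hri⟩ := hX (ULift.{u} (range e)) (ULift.{v} E)
    (fun y => ULift.up (y.down : E)) (fun y => (inv y.down : X))
    (Isometry.of_dist_eq fun a b => rfl)
    (LipschitzWith.of_dist_le_mul fun a b => by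
      have : dist (inv a.down : X) (inv b.down) = dist a b := by
        have h1 := he.dist_eq (inv a.down) (inv b.down)
        rw [hinv, hinv] at h1
        exact h1.symm
      simp [this])
  let ι : X → E := fun x => if hx : x ∈ K then e ⟨x, hx⟩ else 0
  have hι : ∀ x ∈ K, ∀ y ∈ K, ‖ι x - ι y‖ = dist x y := by
    intro x hx y hy
    simp only [ι, hx, hy, dif_pos]
    rw [← dist_eq_norm, he.dist_eq]; rfl
  have hrι : ∀ x ∈ K, r (ULift.up (ι x)) = x := by
    intro x hx
    have h1 := hri (ULift.up ⟨e ⟨x, hx⟩, mem_range_self _⟩)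
    have h2 : inv ⟨e ⟨x, hx⟩, mem_range_self _⟩ = ⟨x, hx⟩ := he.injective (hinv _)
    simp only [h2] at h1
    simpa only [ι, hx, dif_pos] using h1
  have hιc : ContinuousOn ι K := by
    have : LipschitzOnWith 1 ι K := LipschitzOnWith.of_dist_le_mul fun x hx y hy => by
      rw [dist_eq_norm, hι x hx y hy]; simp
    exact this.continuousOn
  have hrd : ∀ a b : E, dist (r (ULift.up a)) (r (ULift.up b)) ≤ ‖a - b‖ := by
    intro a b
    have := hr.dist_le_mul (ULift.up a) (ULift.up b)
    rw [ULift.dist_up_up, dist_eq_norm] at this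
    simpa using this
  have hrc : Continuous fun a : E => r (ULift.up a) := by
    have : LipschitzWith 1 fun a : E => r (ULift.up a) := LipschitzWith.of_dist_le_mul fun a b => by
      rw [dist_eq_norm]; simpa using hrd a b
    exact this.continuous
  refine ⟨fun k s => r (ULift.up (ι c + s • (ι k - ι c))), ?_, ?_, ?_, ?_⟩
  · intro k; simp [hrι c hc]
  · intro k hk; simp [hrι k hk]
  · refine hrc.comp_continuousOn ?_
    have h1 : ContinuousOn (fun q : X × ℝ => ι q.1) (K ×ˢ univ) :=
      hιc.comp continuousOn_fst fun q hq => hq.1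
    exact continuousOn_const.add (continuousOn_snd.smul (h1.sub continuousOn_const))
  · intro k hk y hy s h0 h1
    have := hrd (ι c + s • (ι k - ι c)) (ι y)
    rw [hrι y hy] at this
    refine this.trans ?_
    have h2 : ι c + s • (ι k - ι c) - ι y = s • (ι k - ι y) + (1 - s) • (ι c - ι y) := by
      module
    rw [h2]
    refine (norm_add_le _ _).trans ?_
    rw [norm_smul, norm_smul, hι k hk y hy, hι c hc y hy, Real.norm_of_nonneg h0,
      Real.norm_of_nonneg (sub_nonneg.2 h1)]

/-- Max-normalised simplex on the finite vertex set `σ`. -/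
def MaxSimplex {V : Type w} (σ : Finset V) : Set (V → ℝ) :=
  {z | (∀ v, z v ∈ Icc (0 : ℝ) 1) ∧ (∀ v, v ∉ σ → z v = 0) ∧ ∃ v ∈ σ, z v = 1}

/-- Its boundary. -/
def MaxBd {V : Type w} (σ : Finset V) : Set (V → ℝ) :=
  {z | z ∈ MaxSimplex σ ∧ ∃ v ∈ σ, z v = 0}

theorem maxSimplex_closed {V : Type w} (σ : Finset V) : IsClosed (MaxSimplex σ) := by
  have : MaxSimplex σ = (⋂ v, {z : V → ℝ | z v ∈ Icc (0 : ℝ) 1}) ∩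
      ((⋂ v, ⋂ (_ : v ∉ σ), {z : V → ℝ | z v = 0}) ∩ ⋃ v ∈ σ, {z : V → ℝ | z v = 1}) := by
    ext z; simp [MaxSimplex]
  rw [this]
  refine (isClosed_iInter fun v => isClosed_Icc.preimage (continuous_apply v)).inter
    ((isClosed_iInter fun v => isClosed_iInter fun _ =>
      isClosed_eq (continuous_apply v) continuous_const).inter ?_)
  exact isClosed_biUnion_finset fun v _ => isClosed_eq (continuous_apply v) continuous_const

theorem maxBd_compact {V : Type w} (σ : Finset V) : IsCompact (MaxBd σ) := by
  have h : MaxBd σ = MaxSimplex σ ∩ ⋃ v ∈ σ, {z : V → ℝ | z v = 0} := by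
    ext z; simp [MaxBd]
  have hcl : IsClosed (MaxBd σ) := by
    rw [h]
    exact (maxSimplex_closed σ).inter
      (isClosed_biUnion_finset fun v _ => isClosed_eq (continuous_apply v) continuous_const)
  refine (isCompact_univ_pi fun _ : V => isCompact_Icc (a := (0 : ℝ)) (b := 1)).of_isClosed_subset
    hcl ?_
  intro z hz v _
  exact hz.1.1 v

theorem inj_ext (X : Type w) [MetricSpace X] (hX : IsInjMetric.{u, v} X)
    {V : Type w} (φ : V → X) (σ : Finset V) (b : (V → ℝ) → X)
    (hb : ContinuousOn b (MaxBd σ)) :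
    ∃ g : (V → ℝ) → X, ContinuousOn g (MaxSimplex σ) ∧ EqOn g b (MaxBd σ) ∧
      ∀ z ∈ MaxSimplex σ, ∀ v, z v = 1 → ∀ R : ℝ, (∀ u ∈ σ, dist (φ u) (φ v) ≤ R) →
        (∀ z' ∈ MaxBd σ, z' v = 1 → dist (b z') (φ v) ≤ R) → dist (g z) (φ v) ≤ R := by
  classical
  rcases σ.eq_empty_or_nonempty with rfl | hσ
  · have h0 : MaxSimplex (∅ : Finset V) = ∅ := by ext z; simp [MaxSimplex]
    have h1 : MaxBd (∅ : Finset V) = ∅ := by ext z; simp [MaxBd]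
    exact ⟨b, by simp [h0], by simp [h1], by simp [h0]⟩
  obtain ⟨u0, hu0⟩ := id hσ
  let K : Set X := b '' MaxBd σ ∪ φ '' (σ : Set V)
  have hK : IsCompact K :=
    ((maxBd_compact σ).image_of_continuousOn hb).union (σ.finite_toSet.image φ).isCompact
  have hφK : ∀ u ∈ σ, φ u ∈ K := fun u hu => Or.inr ⟨u, hu, rfl⟩
  obtain ⟨h, hh0, hh1, hhc, hhd⟩ := inj_cone X hX K hK (φ u0) (hφK u0 hu0)
  let m : (V → ℝ) → ℝ := fun z => σ.inf' hσ fun v => z v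
  have hm : Continuous m := Continuous.finset_inf'_apply hσ fun v _ => continuous_apply v
  have hmle : ∀ z, ∀ v ∈ σ, m z ≤ z v := fun z v hv => Finset.inf'_le _ hv
  have hmex : ∀ z, ∃ v ∈ σ, m z = z v := fun z => Finset.exists_mem_eq_inf' hσ _
  have hm0 : ∀ z ∈ MaxSimplex σ, 0 ≤ m z := by
    intro z hz
    obtain ⟨v, hv, e⟩ := hmex z
    rw [e]; exact (hz.1 v).1
  have hm1 : ∀ z ∈ MaxSimplex σ, m z ≤ 1 := by
    intro z hz
    obtain ⟨v, hv, e⟩ := hmex z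
    rw [e]; exact (hz.1 v).2
  let P : (V → ℝ) → (V → ℝ) := fun z v => if v ∈ σ then (z v - m z) / (1 - m z) else 0
  have hP : ∀ z ∈ MaxSimplex σ, m z < 1 → P z ∈ MaxBd σ := by
    intro z hz hlt
    have hpos : 0 < 1 - m z := sub_pos.2 hlt
    refine ⟨⟨?_, ?_, ?_⟩, ?_⟩
    · intro v
      by_cases hv : v ∈ σ
      · simp only [P, hv, if_true]
        refine ⟨div_nonneg (sub_nonneg.2 (hmle z v hv)) hpos.le, ?_⟩
        rw [div_le_one hpos]
        linarith [(hz.1 v).2]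
      · simp [P, hv]
    · intro v hv; simp [P, hv]
    · obtain ⟨v, hv, e⟩ := hz.2.2
      refine ⟨v, hv, ?_⟩
      simp only [P, hv, if_true, e]
      exact div_self hpos.ne'
    · obtain ⟨v, hv, e⟩ := hmex z
      exact ⟨v, hv, by simp [P, hv, e]⟩
  have hbK : ∀ z ∈ MaxSimplex σ, m z < 1 → b (P z) ∈ K := fun z hz hlt =>
    Or.inl ⟨_, hP z hz hlt, rfl⟩
  have hPc : ContinuousOn P {z | m z < 1} := by
    rw [continuousOn_pi]
    intro v
    by_cases hv : v ∈ σ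
    · simp only [P, hv, if_true]
      refine ContinuousOn.div ?_ ?_ ?_
      · exact ((continuous_apply v).sub hm).continuousOn
      · exact (continuous_const.sub hm).continuousOn
      · intro z hz; exact (sub_pos.2 hz).ne'
    · simp only [P, hv, if_false]; exact continuousOn_const
  obtain ⟨C, hC⟩ := Metric.isBounded_iff.1 hK.isBounded
  have hg1 : ∀ z ∈ MaxSimplex σ, dist (h (b (P z)) (1 - m z)) (φ u0) ≤ (1 - m z) * C := by
    intro z hz
    rcases (hm1 z hz).lt_or_eq with hlt | heq
    · have := hhd _ (hbK z hz hlt) _ (hφK u0 hu0) (1 - m z) (by linarith) (by linarith [hm0 z hz])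
      rw [dist_self, mul_zero, add_zero] at this
      exact this.trans (mul_le_mul_of_nonneg_left (hC (hbK z hz hlt) (hφK u0 hu0)) (by linarith))
    · rw [heq, sub_self, hh0]; simp
  refine ⟨fun z => h (b (P z)) (1 - m z), ?_, ?_, ?_⟩
  · intro z0 hz0
    rcases (hm1 z0 hz0).lt_or_eq with hlt | heq
    · have hcont : ContinuousOn (fun z => h (b (P z)) (1 - m z))
          (MaxSimplex σ ∩ {z | m z < 1}) := by
        have h1 : ContinuousOn (fun z => (b (P z), 1 - m z)) (MaxSimplex σ ∩ {z | m z < 1}) := by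
          refine ContinuousOn.prodMk ?_ (continuous_const.sub hm).continuousOn
          exact hb.comp (hPc.mono inter_subset_right) fun z hz => hP z hz.1 hz.2
        exact hhc.comp h1 fun z hz => ⟨hbK z hz.1 hz.2, mem_univ _⟩
      refine (hcont z0 ⟨hz0, hlt⟩).mono_of_mem_nhdsWithin ?_
      exact inter_mem self_mem_nhdsWithin
        (mem_nhdsWithin_of_mem_nhds ((isOpen_lt hm continuous_const).mem_nhds hlt))
    · have he : h (b (P z0)) (1 - m z0) = φ u0 := by rw [heq, sub_self, hh0]
      unfold ContinuousWithinAt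
      simp only [he]
      rw [tendsto_iff_dist_tendsto_zero]
      have hlim : Tendsto (fun z => (1 - m z) * C) (𝓝[MaxSimplex σ] z0) (𝓝 0) := by
        have : Tendsto (fun z => (1 - m z) * C) (𝓝 z0) (𝓝 ((1 - m z0) * C)) :=
          ((continuous_const.sub hm).mul continuous_const).tendsto z0
        rw [heq, sub_self, zero_mul] at this
        exact this.mono_left nhdsWithin_le_nhds
      refine squeeze_zero' (Eventually.of_forall fun _ => dist_nonneg) ?_ hlim
      filter_upwards [self_mem_nhdsWithin] with z hz using hg1 z hz
  · intro z hz
    have hmz : m z = 0 := by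
      obtain ⟨v, hv, e⟩ := hz.2
      exact le_antisymm (e ▸ hmle z v hv) (hm0 z hz.1)
    have hPz : P z = z := by
      funext v
      by_cases hv : v ∈ σ
      · simp [P, hv, hmz]
      · simp [P, hv, hz.1.2.1 v hv]
    simp only [hmz, hPz, sub_zero]
    exact hh1 _ (Or.inl ⟨z, hz, rfl⟩)
  · intro z hz v hv R hR hbR
    have hvσ : v ∈ σ := by
      by_contra hn
      rw [hz.2.1 v hn] at hv
      exact zero_ne_one hv
    simp only
    rcases (hm1 z hz).lt_or_eq with hlt | heq
    · have h1 := hhd _ (hbK z hz hlt) _ (hφK v hvσ) (1 - m z) (by linarith)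
        (by linarith [hm0 z hz])
      have h2 := hbR (P z) (hP z hz hlt) (by
        simp only [P, hvσ, if_true, hv]
        exact div_self (sub_pos.2 hlt).ne')
      have h3 := hR u0 hu0
      have h4 := hm0 z hz
      nlinarith
    · rw [heq, sub_self, hh0]
      exact hR u0 hu0

theorem maxBd_continuousOn {X : Type w} [TopologicalSpace X] {V : Type w} [DecidableEq V]
    (σ : Finset V) (b : (V → ℝ) → X)
    (hb : ∀ v ∈ σ, ContinuousOn b (MaxSimplex (σ.erase v))) : ContinuousOn b (MaxBd σ) := by
  have h : MaxBd σ ⊆ ⋃ v : σ, MaxSimplex (σ.erase v.1) := by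
    rintro z ⟨hz, v, hv, e⟩
    refine mem_iUnion.2 ⟨⟨v, hv⟩, hz.1, ?_, ?_⟩
    · intro u hu
      by_cases huv : u = v
      · rw [huv, e]
      · exact hz.2.1 u fun hh => hu (Finset.mem_erase.2 ⟨huv, hh⟩)
    · obtain ⟨u, hu, e'⟩ := hz.2.2
      refine ⟨u, Finset.mem_erase.2 ⟨?_, hu⟩, e'⟩
      rintro rfl
      rw [e] at e'
      exact zero_ne_one e'
  refine ContinuousOn.mono ?_ h
  exact (locallyFinite_of_finite _).continuousOn_iUnion (fun v => maxSimplex_closed _)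
    fun v => hb v.1 v.2

/-- Filling all simplices at once. -/
theorem inj_fill (X : Type w) [MetricSpace X] (hX : IsInjMetric.{u, v} X)
    {V : Type w} (φ : V → X) (p : X) :
    ∃ Φ : (V → ℝ) → X, ∀ σ : Finset V, ContinuousOn Φ (MaxSimplex σ) ∧
      ∀ z ∈ MaxSimplex σ, ∀ v, z v = 1 → ∀ R : ℝ, (∀ u ∈ σ, dist (φ u) (φ v) ≤ R) →
        dist (Φ z) (φ v) ≤ R := by
  classical
  have hE : ∀ (σ : Finset V) (b : (V → ℝ) → X), ∃ g : (V → ℝ) → X, ContinuousOn b (MaxBd σ) →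
      ContinuousOn g (MaxSimplex σ) ∧ EqOn g b (MaxBd σ) ∧
      ∀ z ∈ MaxSimplex σ, ∀ v, z v = 1 → ∀ R : ℝ, (∀ u ∈ σ, dist (φ u) (φ v) ≤ R) →
        (∀ z' ∈ MaxBd σ, z' v = 1 → dist (b z') (φ v) ≤ R) → dist (g z) (φ v) ≤ R := by
    intro σ b
    by_cases hb : ContinuousOn b (MaxBd σ)
    · obtain ⟨g, hg⟩ := inj_ext X hX φ σ b hb
      exact ⟨g, fun _ => hg⟩
    · exact ⟨b, fun h => absurd h hb⟩
  choose E hE using hE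
  -- the support of `z` as a finite set (junk if infinite)
  let sp : (V → ℝ) → Finset V := fun z =>
    if h : (Function.support z).Finite then h.toFinset else ∅
  have hsp : ∀ σ : Finset V, ∀ z ∈ MaxSimplex σ, ∀ v, v ∈ sp z ↔ z v ≠ 0 := by
    intro σ z hz v
    have hf : (Function.support z).Finite := σ.finite_toSet.subset fun u hu => by
      by_contra hn
      exact hu (hz.2.1 u hn)
    simp [sp, hf]
  have hspsub : ∀ σ : Finset V, ∀ z ∈ MaxSimplex σ, sp z ⊆ σ := by
    intro σ z hz v hv
    by_contra hn
    exact (hsp σ z hz v).1 hv (hz.2.1 v hn)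
  have hspmem : ∀ σ : Finset V, ∀ z ∈ MaxSimplex σ, z ∈ MaxSimplex (sp z) := by
    intro σ z hz
    refine ⟨hz.1, fun v hv => ?_, ?_⟩
    · by_contra hn
      exact hv ((hsp σ z hz v).2 hn)
    · obtain ⟨v, hv, e⟩ := hz.2.2
      exact ⟨v, (hsp σ z hz v).2 (by rw [e]; exact one_ne_zero), e⟩
  let F : ℕ → (V → ℝ) → X := fun n => Nat.rec (fun _ => p)
    (fun n f z => if (sp z).card = n + 1 then E (sp z) f z else f z) n
  have hF : ∀ n z, F (n + 1) z = if (sp z).card = n + 1 then E (sp z) (F n) z else F n z :=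
    fun n z => rfl
  have hQ : ∀ n, ∀ σ : Finset V, σ.card ≤ n → ContinuousOn (F n) (MaxSimplex σ) ∧
      ∀ z ∈ MaxSimplex σ, ∀ v, z v = 1 → ∀ R : ℝ, (∀ u ∈ σ, dist (φ u) (φ v) ≤ R) →
        dist (F n z) (φ v) ≤ R := by
    intro n
    induction n with
    | zero =>
      intro σ hσ
      have : σ = ∅ := Finset.card_eq_zero.1 (Nat.le_zero.1 hσ)
      subst this
      have h0 : MaxSimplex (∅ : Finset V) = ∅ := by ext z; simp [MaxSimplex]
      simp [h0]
    | succ n ih =>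
      intro σ hσ
      rcases Nat.lt_or_ge n σ.card with hlt | hle
      · have hcard : σ.card = n + 1 := by omega
        have herase : ∀ v ∈ σ, (σ.erase v).card ≤ n := by
          intro v hv
          rw [Finset.card_erase_of_mem hv]; omega
        have hb : ContinuousOn (F n) (MaxBd σ) :=
          maxBd_continuousOn σ _ fun v hv => (ih _ (herase v hv)).1
        obtain ⟨h1, h2, h3⟩ := hE σ (F n) hb
        have hbdsp : ∀ z ∈ MaxBd σ, (sp z).card ≤ n := by
          rintro z ⟨hz, v, hv, e⟩
          have : sp z ⊂ σ := by
            refine (Finset.ssubset_iff_of_subset (hspsub σ z hz)).2 ⟨v, hv, fun hn => ?_⟩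
            exact (hsp σ z hz v).1 hn e
          have := Finset.card_lt_card this
          omega
        have heq : EqOn (F (n + 1)) (E σ (F n)) (MaxSimplex σ) := by
          intro z hz
          rw [hF]
          by_cases hc : (sp z).card = n + 1
          · have : sp z = σ := Finset.eq_of_subset_of_card_le (hspsub σ z hz) (by omega)
            rw [if_pos hc, this]
          · rw [if_neg hc]
            refine (h2 ⟨hz, ?_⟩).symm
            by_contra hn
            push Not at hn
            apply hc
            have : sp z = σ := Finset.Subset.antisymm (hspsub σ z hz) fun v hv =>
              (hsp σ z hz v).2 (hn v hv)
            rw [this, hcard]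
        refine ⟨h1.congr heq, ?_⟩
        intro z hz v hv R hR
        rw [heq hz]
        refine h3 z hz v hv R hR ?_
        intro z' hz' hv'
        exact (ih (sp z') (hbdsp z' hz')).2 z' (hspmem σ z' hz'.1) v hv' R
          fun u hu => hR u (hspsub σ z' hz'.1 hu)
      · have heq : EqOn (F (n + 1)) (F n) (MaxSimplex σ) := by
          intro z hz
          have := Finset.card_le_card (hspsub σ z hz)
          rw [hF, if_neg (by omega)]
        refine ⟨(ih σ hle).1.congr heq, ?_⟩
        intro z hz v hv R hR
        rw [heq hz]
        exact (ih σ hle).2 z hz v hv R hR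
  have hstab : ∀ n z, (sp z).card ≤ n → F n z = F (sp z).card z := by
    intro n z hn
    induction n, hn using Nat.le_induction with
    | base => rfl
    | succ k hk ih => rw [hF, if_neg (by omega), ih]
  refine ⟨fun z => F (sp z).card z, fun σ => ?_⟩
  have heq : EqOn (fun z => F (sp z).card z) (F σ.card) (MaxSimplex σ) := fun z hz =>
    (hstab _ z (Finset.card_le_card (hspsub σ z hz))).symm
  refine ⟨(hQ _ σ le_rfl).1.congr heq, ?_⟩
  intro z hz v hv R hR
  rw [heq hz]
  exact (hQ _ σ le_rfl).2 z hz v hv R hR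

/-- Every nonempty injective metric space is contractible. -/
theorem injective_is_contractible (X : Type w) [MetricSpace X] [Nonempty X]
    (hX : IsInjMetric.{u, v} X) :
    ∃ (p : X) (H : X × unitInterval → X), Continuous H ∧
      (∀ x : X, H (x, 0) = x) ∧ (∀ x : X, H (x, 1) = p) := by
  classical
  obtain ⟨p⟩ := ‹Nonempty X›
  let O : Set (X × unitInterval) := {q | (0 : ℝ) < q.2}
  have hO : IsOpen O := isOpen_lt continuous_const (continuous_subtype_val.comp continuous_snd)
  let U : O → Set O := fun a =>
    {q | dist q.1.1 a.1.1 < (q.1.2 : ℝ) ∧ |(q.1.2 : ℝ) - (a.1.2 : ℝ)| < 1 / 4}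
  have hU : ∀ a, IsOpen (U a) := by
    intro a
    have h1 : IsOpen {q : O | dist q.1.1 a.1.1 < (q.1.2 : ℝ)} :=
      isOpen_lt (by fun_prop) (by fun_prop)
    have h2 : IsOpen {q : O | |(q.1.2 : ℝ) - (a.1.2 : ℝ)| < 1 / 4} :=
      isOpen_lt (by fun_prop) (by fun_prop)
    exact h1.inter h2
  obtain ⟨f, hf⟩ := BumpCovering.exists_isSubordinate (isClosed_univ (X := O)) U hU (by
    intro a _
    refine mem_iUnion.2 ⟨a, ?_, ?_⟩
    · rw [dist_self]; exact a.2
    · simp)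
  let φ : O → X := fun a => if (a.1.2 : ℝ) < 1 / 2 then a.1.1 else p
  obtain ⟨Φ, hΦ⟩ := inj_fill X hX φ p
  let β : O → (O → ℝ) := fun q a => f a q
  have hβc : Continuous β := continuous_pi fun a => (f a).continuous
  have hβ : ∀ q (σ : Finset O), (∀ a, f a q ≠ 0 → a ∈ σ) → β q ∈ MaxSimplex σ := by
    intro q σ h
    refine ⟨fun a => ⟨f.nonneg a q, f.le_one a q⟩, fun a ha => ?_, ?_⟩
    · by_contra hn
      exact ha (h a hn)
    · have h1 := f.ind_apply q (mem_univ q)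
      exact ⟨f.ind q (mem_univ q), h _ (by rw [h1]; exact one_ne_zero), h1⟩
  have hsub : ∀ q a, f a q ≠ 0 → q ∈ U a := fun q a h => hf a (subset_closure h)
  have hG : Continuous fun q => Φ (β q) := by
    rw [continuous_iff_continuousAt]
    intro q0
    obtain ⟨I, hI⟩ := f.locallyFinite.exists_finset_support q0
    have hmem : ∀ᶠ q in 𝓝 q0, β q ∈ MaxSimplex I :=
      hI.mono fun q hq => hβ q I fun a ha => hq ha
    have h1 := (hΦ I).1 (β q0) hmem.self_of_nhds
    exact Tendsto.comp h1 (tendsto_nhdsWithin_iff.2 ⟨hβc.continuousAt, hmem⟩)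
  have hbound : ∀ q : O, ∃ a : O, f a q ≠ 0 ∧ ∀ R : ℝ,
      (∀ a', f a' q ≠ 0 → dist (φ a') (φ a) ≤ R) → dist (Φ (β q)) (φ a) ≤ R := by
    intro q
    have h1 := f.ind_apply q (mem_univ q)
    refine ⟨f.ind q (mem_univ q), by rw [h1]; exact one_ne_zero, fun R hR => ?_⟩
    refine (hΦ (f.point_finite q).toFinset).2 (β q) (hβ q _ fun a ha => by simpa using ha) _ h1 R
      fun a ha => hR a (by simpa using ha)
  have hsmall : ∀ q : O, (q.1.2 : ℝ) < 1 / 4 → dist (Φ (β q)) q.1.1 ≤ 3 * (q.1.2 : ℝ) := by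
    intro q hq
    have hφ : ∀ a, f a q ≠ 0 → dist q.1.1 (φ a) < q.1.2 := by
      intro a ha
      obtain ⟨h1, h2⟩ := hsub q a ha
      have : (a.1.2 : ℝ) < 1 / 2 := by
        have := (abs_lt.1 h2).1
        linarith
      simpa only [φ, this, if_true] using h1
    obtain ⟨a, ha, hR⟩ := hbound q
    have h1 := hR (2 * q.1.2) fun a' ha' => by
      have := dist_triangle_left (φ a') (φ a) q.1.1
      linarith [hφ a ha, hφ a' ha']
    have h2 := dist_triangle_right (Φ (β q)) q.1.1 (φ a)
    linarith [hφ a ha]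
  have hone : ∀ q : O, (q.1.2 : ℝ) = 1 → Φ (β q) = p := by
    intro q hq
    have hφ : ∀ a, f a q ≠ 0 → φ a = p := by
      intro a ha
      obtain ⟨h1, h2⟩ := hsub q a ha
      have : ¬ (a.1.2 : ℝ) < 1 / 2 := by
        have := (abs_lt.1 h2).2
        linarith
      simp only [φ, this, if_false]
    obtain ⟨a, ha, hR⟩ := hbound q
    have h1 := hR 0 fun a' ha' => by rw [hφ a ha, hφ a' ha', dist_self]
    rw [hφ a ha] at h1
    exact dist_le_zero.1 h1
  let H : X × unitInterval → X := fun q => if hq : q ∈ O then Φ (β ⟨q, hq⟩) else q.1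
  refine ⟨p, H, ?_, ?_, ?_⟩
  · rw [continuous_iff_continuousAt]
    rintro q0
    by_cases hq0 : q0 ∈ O
    · have h1 : ContinuousOn H O := by
        rw [continuousOn_iff_continuous_restrict]
        refine hG.congr fun q => ?_
        simp [H, restrict]
      exact h1.continuousAt (hO.mem_nhds hq0)
    · have hz : (q0.2 : ℝ) = 0 := le_antisymm (not_lt.1 hq0) q0.2.2.1
      have hH0 : H q0 = q0.1 := by simp only [H, hq0, dif_neg, not_false_eq_true]
      unfold ContinuousAt
      rw [hH0, tendsto_iff_dist_tendsto_zero]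
      have hc : Continuous fun q : X × unitInterval => 3 * (q.2 : ℝ) + dist q.1 q0.1 := by fun_prop
      have hlim := hc.tendsto q0
      simp only [hz, mul_zero, dist_self, add_zero] at hlim
      refine squeeze_zero' (Eventually.of_forall fun _ => dist_nonneg) ?_ hlim
      have hc2 : Continuous fun q : X × unitInterval => (q.2 : ℝ) := by fun_prop
      have hev : ∀ᶠ q in 𝓝 q0, (q.2 : ℝ) < 1 / 4 :=
        (isOpen_lt hc2 continuous_const).mem_nhds (by simp [hz])
      filter_upwards [hev] with q hq
      by_cases hqO : q ∈ O
      · simp only [H, hqO, dif_pos]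
        have h1 := hsmall ⟨q, hqO⟩ hq
        have h2 := dist_triangle (Φ (β ⟨q, hqO⟩)) q.1 q0.1
        simp only at h1
        linarith
      · simp only [H, hqO, dif_neg, not_false_eq_true]
        have := q.2.2.1
        linarith
  · intro x
    simp [H, O]
  · intro x
    have hx : ((x, 1) : X × unitInterval) ∈ O := by simp [O]
    simp only [H, hx, dif_pos]
    exact hone ⟨(x, 1), hx⟩ (by simp)
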